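/- Fix U ≥ 2, a weight W as described, real numbers x, y > 0, real numbers c₁, c₂ with 1 < c₁ < c₂ < 2, and c₃ = 3/2. Then C(x,y) = (1/(2πi))² ∫_{Re s₁ = c₁} ∫_{Re s₂ = c₂} H(s₁, s₂; y) · (x^{s₁+s₂} / (ζ(s₁) ζ(s₂))) · Ŵ(s₁) Ŵ(s₂) ds₂ ds₁, where H(s₁, s₂; y) = (1/(2πi)) ∫_{Re s₃ = c₃} ζ(s₃) ζ(s₃+s₁−1) ζ(s₃+s₂−1) ζ(s₃+s₁+s₂−2) / ζ(2s₃+s₁+s₂−2) · Ŵ(s₃) y^{s₃} ds₃. -/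

import Mathlib

open Complex Filter

/-- The Ramanujan sum `c_q(n) = ∑_{a mod q, gcd(a,q)=1} e(na/q)`. -/
noncomputable def ramanujanSum (q n : ℕ) : ℂ :=
  ∑ a ∈ (Finset.range q).filter (fun a => Nat.Coprime a q),
    Complex.exp (2 * Real.pi * Complex.I * (((n * a : ℕ) : ℂ) / (q : ℂ)))

/-- A smooth weight function attached to a parameter `U ≥ 2`: `0 ≤ W ≤ 1`, supported in
`[1/(2U), 1 + 1/(2U)]`, equal to `1` on `[1/U, 1]`, with `j`-th derivative `≪_j U^j`. -/
structure Weight (U : ℝ) : Type where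
  toFun : ℝ → ℝ
  smooth : ContDiff ℝ (⊤ : ℕ∞) toFun
  nonneg : ∀ t, 0 ≤ toFun t
  le_one : ∀ t, toFun t ≤ 1
  support_subset : ∀ t, t ∉ Set.Icc (1 / (2 * U)) (1 + 1 / (2 * U)) → toFun t = 0
  eq_one : ∀ t ∈ Set.Icc (1 / U) 1, toFun t = 1
  deriv_bound : ∀ j : ℕ, ∃ Cj : ℝ, ∀ t, |iteratedDeriv j toFun t| ≤ Cj * U ^ j

/-- The Mellin transform `Ŵ(s) = ∫_0^∞ W(t) t^{s-1} dt`. -/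
noncomputable def mellinW (W : ℝ → ℝ) (s : ℂ) : ℂ :=
  ∫ t in Set.Ioi (0 : ℝ), (W t : ℂ) * (t : ℂ) ^ (s - 1)

/-- `(1/(2πi)) ∫_{Re s = c} f(s) ds`, the normalized vertical line integral. -/
noncomputable def VI (c : ℝ) (f : ℂ → ℂ) : ℂ :=
  (1 / (2 * Real.pi * Complex.I)) * ∫ t : ℝ, f (c + t * Complex.I) * Complex.I

/-- The smoothed second moment `C(x,y) = ∑_n (∑_q c_q(n) W(q/x))² W(n/y)`. -/
noncomputable def Cxy {U : ℝ} (W : Weight U) (x y : ℝ) : ℂ :=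
  ∑' n : ℕ+, (∑' q : ℕ+, ramanujanSum q n * (W.toFun ((q : ℕ) / x) : ℂ)) ^ 2
    * (W.toFun ((n : ℕ) / y) : ℂ)

/-- The generalized divisor sum `σ_z(n) = ∑_{d ∣ n} d^z`. -/
noncomputable def sigmaC (z : ℂ) (n : ℕ) : ℂ := ∑ d ∈ n.divisors, (d : ℂ) ^ z

open MeasureTheory

lemma mellinW_eq_mellin (W : ℝ → ℝ) (s : ℂ) : mellinW W s = mellin (fun t ↦ (W t : ℂ)) s := by
  simp only [mellinW, mellin, smul_eq_mul, mul_comm]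

lemma VI_eq (c : ℝ) (f : ℂ → ℂ) :
    VI c f = (1 / (2 * Real.pi) : ℂ) * ∫ t : ℝ, f (c + t * Complex.I) := by
  rw [VI, integral_mul_const]
  have := Complex.I_ne_zero
  have : (Real.pi : ℂ) ≠ 0 := by exact_mod_cast Real.pi_ne_zero
  field_simp

lemma VI_congr {c : ℝ} {f g : ℂ → ℂ} (h : ∀ s : ℂ, s.re = c → f s = g s) :
    VI c f = VI c g := by
  rw [VI_eq, VI_eq]
  congr 2
  ext t
  exact h _ (by simp)

lemma VI_mul_const (c : ℝ) (f : ℂ → ℂ) (a : ℂ) : VI c (fun s ↦ f s * a) = VI c f * a := by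
  rw [VI_eq, VI_eq, integral_mul_const, mul_assoc]

lemma VI_const_mul (c : ℝ) (f : ℂ → ℂ) (a : ℂ) : VI c (fun s ↦ a * f s) = a * VI c f := by
  simp only [mul_comm a, VI_mul_const]

lemma VI_finset_sum {ι : Type*} (S : Finset ι) (c : ℝ) (f : ι → ℂ → ℂ)
    (hf : ∀ i ∈ S, Integrable fun t : ℝ ↦ f i (c + t * Complex.I)) :
    VI c (fun s ↦ ∑ i ∈ S, f i s) = ∑ i ∈ S, VI c (f i) := by
  simp only [VI_eq]
  rw [integral_finsetSum _ hf, Finset.mul_sum]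

section Weight

variable {U : ℝ}

lemma Weight.eq_zero_of_nonpos (hU : 2 ≤ U) (W : Weight U) {t : ℝ} (ht : t ≤ 0) :
    W.toFun t = 0 := by
  refine W.support_subset t fun h ↦ ?_
  have : 0 < 1 / (2 * U) := by positivity
  linarith [h.1]

lemma Weight.eq_zero_of_large (hU : 2 ≤ U) (W : Weight U) {t : ℝ} (ht : 2 < t) :
    W.toFun t = 0 := by
  refine W.support_subset t fun h ↦ ?_
  have : 1 / (2 * U) ≤ 1 := by
    rw [div_le_one (by positivity)]
    linarith
  linarith [h.2]

lemma Weight.mellinConvergent (hU : 2 ≤ U) (W : Weight U) (s : ℂ) :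
    MellinConvergent (fun t ↦ (W.toFun t : ℂ)) s := by
  have ha : 0 < 1 / (2 * U) := by positivity
  have hc : ContinuousOn (fun t : ℝ ↦ (t : ℂ) ^ (s - 1) • (W.toFun t : ℂ))
      (Set.Icc (1 / (2 * U)) (1 + 1 / (2 * U))) := by
    have hW : ContinuousOn (fun t ↦ (W.toFun t : ℂ)) (Set.Icc (1 / (2 * U)) (1 + 1 / (2 * U))) :=
      (Complex.continuous_ofReal.comp W.smooth.continuous).continuousOn
    refine ContinuousOn.smul (f := fun t : ℝ ↦ (t : ℂ) ^ (s - 1)) (fun t ht ↦ ?_) hW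
    exact ((continuousAt_ofReal_cpow_const t (s - 1)
      (Or.inr (ha.trans_le ht.1).ne')).continuousWithinAt)
  have hi := hc.integrableOn_compact (μ := volume) isCompact_Icc
  rw [integrableOn_iff_integrable_of_support_subset] at hi
  · exact hi.integrableOn
  · intro t ht
    by_contra h
    exact ht (by simp [W.support_subset t h])

lemma Weight.verticalIntegrable (hU : 2 ≤ U) (W : Weight U) (σ : ℝ) :
    VerticalIntegrable (mellin fun t ↦ (W.toFun t : ℂ)) σ := by
  have ha : 0 < 1 / (2 * U) := by positivity
  set g : ℝ → ℂ := fun u ↦ Real.exp (-σ * u) • (W.toFun (Real.exp (-u)) : ℂ) with hg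
  have hsupp : HasCompactSupport g := by
    refine HasCompactSupport.intro (K := Set.Icc (-Real.log (1 + 1 / (2 * U)))
      (-Real.log (1 / (2 * U)))) isCompact_Icc fun u hu ↦ ?_
    rw [hg]
    simp only
    rw [W.support_subset, Complex.ofReal_zero, smul_zero]
    refine fun h ↦ hu ⟨?_, ?_⟩
    · have := Real.log_le_log (Real.exp_pos _) h.2
      rw [Real.log_exp] at this
      linarith
    · have := Real.log_le_log ha h.1
      rw [Real.log_exp] at this
      linarith
  have hW : ContDiff ℝ (⊤ : ℕ∞) W.toFun := W.smooth
  have hsmooth : ContDiff ℝ (⊤ : ℕ∞) g := by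
    have hexp : ContDiff ℝ (⊤ : ℕ∞) fun u : ℝ ↦ Real.exp (-σ * u) := by fun_prop
    have hexp' : ContDiff ℝ (⊤ : ℕ∞) fun u : ℝ ↦ Real.exp (-u) := by fun_prop
    exact hexp.smul (Complex.ofRealCLM.contDiff.comp (hW.comp hexp'))
  have hint : Integrable (FourierTransform.fourier g) := by
    have := (FourierTransform.fourier (hsupp.toSchwartzMap hsmooth)).integrable (μ := volume)
    rw [SchwartzMap.fourier_coe] at this
    exact this
  have h2π : (2 * Real.pi) ≠ 0 := by positivity
  have := hint.comp_div h2π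
  refine this.congr (Eventually.of_forall fun y ↦ ?_)
  simp [mellin_eq_fourier, hg]

lemma Weight.integrable_mellinW (hU : 2 ≤ U) (W : Weight U) (c : ℝ) :
    Integrable fun t : ℝ ↦ mellinW W.toFun (c + t * Complex.I) := by
  simp only [mellinW_eq_mellin]
  exact W.verticalIntegrable hU c

lemma Weight.eq_VI (hU : 2 ≤ U) (W : Weight U) (c : ℝ) {u : ℝ} (hu : 0 < u) :
    (W.toFun u : ℂ) = VI c fun s ↦ mellinW W.toFun s * (u : ℂ) ^ (-s) := by
  have h := mellinInv_mellin_eq c (fun t ↦ (W.toFun t : ℂ)) hu (W.mellinConvergent hU c)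
    (W.verticalIntegrable hU c)
    (Complex.continuous_ofReal.comp W.smooth.continuous).continuousAt
  rw [← h, VI_eq, mellinInv]
  simp [mellinW_eq_mellin, mul_comm]

end Weight

section Perron

lemma continuous_term_line (a : ℕ → ℂ) (c : ℝ) (n : ℕ) :
    Continuous fun t : ℝ ↦ LSeries.term a (c + t * Complex.I) n := by
  rcases eq_or_ne n 0 with rfl | hn
  · simpa using continuous_const
  · simp only [LSeries.term_of_ne_zero hn]
    have hn' : (n : ℂ) ≠ 0 := by exact_mod_cast hn
    refine continuous_const.div ?_ fun t ↦ by simp [Complex.cpow_eq_zero_iff, hn']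
    exact Continuous.const_cpow (by fun_prop) (Or.inl hn')

lemma norm_term_line (a : ℕ → ℂ) (c t : ℝ) (n : ℕ) :
    ‖LSeries.term a (c + t * Complex.I) n‖ = ‖LSeries.term a c n‖ := by
  simp [LSeries.norm_term_eq]

variable {a : ℕ → ℂ} {c : ℝ}

lemma norm_cpow_line {x : ℝ} (hx : 0 < x) (c t : ℝ) :
    ‖(x : ℂ) ^ ((c : ℂ) + t * Complex.I)‖ = x ^ c := by
  simp [Complex.norm_cpow_eq_rpow_re_of_pos hx]

lemma continuous_cpow_line {x : ℝ} (hx : 0 < x) (c : ℝ) :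
    Continuous fun t : ℝ ↦ (x : ℂ) ^ ((c : ℂ) + t * Complex.I) :=
  Continuous.const_cpow (by fun_prop) (Or.inl (by exact_mod_cast hx.ne'))

lemma continuous_LSeries_line (ha : LSeriesSummable a c) :
    Continuous fun t : ℝ ↦ LSeries a (c + t * Complex.I) :=
  continuous_tsum (continuous_term_line a c) ha.norm fun n t ↦ (norm_term_line a c t n).le

lemma norm_LSeries_line_le (ha : LSeriesSummable a c) (t : ℝ) :
    ‖LSeries a (c + t * Complex.I)‖ ≤ ∑' n, ‖LSeries.term a c n‖ := by
  refine (norm_tsum_le_tsum_norm ?_).trans_eq (by simp only [norm_term_line])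
  simpa only [norm_term_line] using ha.norm

variable {U : ℝ}

lemma Weight.integrable_mellinW_mul_cpow (hU : 2 ≤ U) (W : Weight U) {x : ℝ} (hx : 0 < x)
    (c : ℝ) :
    Integrable fun t : ℝ ↦ mellinW W.toFun (c + t * Complex.I) *
      (x : ℂ) ^ ((c : ℂ) + t * Complex.I) :=
  (W.integrable_mellinW hU c).mul_bdd (c := x ^ c) (continuous_cpow_line hx c).aestronglyMeasurable
    (Eventually.of_forall fun t ↦ (norm_cpow_line hx c t).le)

lemma Weight.integrable_LSeries_mul (hU : 2 ≤ U) (W : Weight U) {x : ℝ} (hx : 0 < x)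
    (ha : LSeriesSummable a c) :
    Integrable fun t : ℝ ↦ LSeries a (c + t * Complex.I) * (mellinW W.toFun (c + t * Complex.I) *
      (x : ℂ) ^ ((c : ℂ) + t * Complex.I)) :=
  (W.integrable_mellinW_mul_cpow hU hx c).bdd_mul
    (continuous_LSeries_line ha).aestronglyMeasurable
    (Eventually.of_forall (norm_LSeries_line_le ha))

/-- Smoothed sums of the coefficients of an absolutely convergent Dirichlet series. -/
lemma Weight.tsum_eq_VI (hU : 2 ≤ U) (W : Weight U) {x : ℝ} (hx : 0 < x)
    (ha : LSeriesSummable a c) :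
    ∑' n : ℕ+, a n * (W.toFun ((n : ℕ) / x) : ℂ) =
      VI c fun s ↦ LSeries a s * (mellinW W.toFun s * (x : ℂ) ^ s) := by
  have h0 : Function.support (fun n : ℕ ↦ a n * (W.toFun (n / x) : ℂ)) ⊆
      Set.range ((↑) : ℕ+ → ℕ) := by
    intro n hn
    rcases Nat.eq_zero_or_pos n with rfl | h
    · simp [W.eq_zero_of_nonpos hU le_rfl] at hn
    · exact ⟨⟨n, h⟩, rfl⟩
  rw [PNat.coe_injective.tsum_eq h0]
  have hterm : ∀ n : ℕ, a n * (W.toFun (n / x) : ℂ) =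
      VI c fun s ↦ LSeries.term a s n * (mellinW W.toFun s * (x : ℂ) ^ s) := by
    intro n
    rcases Nat.eq_zero_or_pos n with rfl | h
    · simp [W.eq_zero_of_nonpos hU le_rfl, VI]
    · have hn : (0 : ℝ) < n := by exact_mod_cast h
      rw [W.eq_VI hU c (div_pos hn hx), ← VI_const_mul]
      refine VI_congr fun s _ ↦ ?_
      rw [LSeries.term_of_ne_zero h.ne', Complex.ofReal_div,
        Complex.div_cpow_ofReal_nonneg hn.le hx.le, Complex.cpow_neg, Complex.cpow_neg]
      simp
      ring
  simp only [hterm, VI_eq, LSeries, ← tsum_mul_right]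
  rw [tsum_mul_left]
  congr 1
  refine (hasSum_integral_of_summable_integral_norm (fun n ↦ ?_) ?_).tsum_eq
  · exact (W.integrable_mellinW_mul_cpow hU hx c).bdd_mul
      (continuous_term_line a c n).aestronglyMeasurable
      (Eventually.of_forall fun t ↦ (norm_term_line a c t n).le)
  · simp only [norm_mul, norm_term_line, integral_const_mul]
    exact ha.norm.mul_right _

end Perron

section RamanujanSum

lemma ramanujanSum_eq_sum_primitiveRoots {q : ℕ} (hq : q ≠ 0) (n : ℕ) :
    ramanujanSum q n = ∑ ζ ∈ primitiveRoots q ℂ, ζ ^ n := by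
  have hω := Complex.isPrimitiveRoot_exp q hq
  refine Finset.sum_bij (fun a _ ↦ Complex.exp (2 * Real.pi * Complex.I * (a / q))) ?_ ?_ ?_ ?_
  · intro a ha
    rw [mem_primitiveRoots (Nat.pos_of_ne_zero hq)]
    exact Complex.isPrimitiveRoot_exp_of_coprime a q hq (Finset.mem_filter.mp ha).2
  · intro a ha b hb hab
    simp only [Finset.mem_filter, Finset.mem_range] at ha hb
    refine hω.pow_inj ha.1 hb.1 ?_
    rw [← Complex.exp_nat_mul, ← Complex.exp_nat_mul]
    convert hab using 2 <;> ring
  · intro ζ hζ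
    rw [mem_primitiveRoots (Nat.pos_of_ne_zero hq), Complex.isPrimitiveRoot_iff _ _ hq] at hζ
    obtain ⟨i, hi, hc, h⟩ := hζ
    exact ⟨i, Finset.mem_filter.mpr ⟨Finset.mem_range.mpr hi, hc⟩, h⟩
  · intro a _
    rw [← Complex.exp_nat_mul]
    congr 1
    push_cast
    ring

lemma sum_nthRootsFinset_pow {q : ℕ} (hq : q ≠ 0) (n : ℕ) :
    ∑ ζ ∈ Polynomial.nthRootsFinset q (1 : ℂ), ζ ^ n = if q ∣ n then (q : ℂ) else 0 := by
  have hω := Complex.isPrimitiveRoot_exp q hq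
  split_ifs with h
  · obtain ⟨m, rfl⟩ := h
    rw [Finset.sum_congr rfl (g := fun _ ↦ (1 : ℂ)), Finset.sum_const, hω.card_nthRootsFinset]
    · simp
    · intro ζ hζ
      rw [Polynomial.mem_nthRootsFinset (Nat.pos_of_ne_zero hq)] at hζ
      rw [pow_mul, hζ, one_pow]
  · set ω := Complex.exp (2 * Real.pi * Complex.I / q)
    have hne : ω ^ n ≠ 1 := fun h1 ↦ h (hω.dvd_of_pow_eq_one n h1)
    have hω1 : ω ^ q = 1 := hω.pow_eq_one
    have hω0 : ω ≠ 0 := hω.ne_zero hq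
    have key : ω ^ n * ∑ ζ ∈ Polynomial.nthRootsFinset q (1 : ℂ), ζ ^ n =
        ∑ ζ ∈ Polynomial.nthRootsFinset q (1 : ℂ), ζ ^ n := by
      rw [Finset.mul_sum]
      refine Finset.sum_bij' (fun ζ _ ↦ ω * ζ) (fun ζ _ ↦ ω⁻¹ * ζ) ?_ ?_ ?_ ?_ ?_
      · intro ζ hζ
        rw [Polynomial.mem_nthRootsFinset (Nat.pos_of_ne_zero hq)] at hζ ⊢
        rw [mul_pow, hζ, hω1, one_mul]
      · intro ζ hζ
        rw [Polynomial.mem_nthRootsFinset (Nat.pos_of_ne_zero hq)] at hζ ⊢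
        rw [mul_pow, hζ, inv_pow, hω1, inv_one, one_mul]
      · intro ζ _
        field_simp
      · intro ζ _
        field_simp
      · intro ζ _
        rw [mul_pow]
    by_contra h0
    exact hne (mul_right_cancel₀ h0 (key.trans (one_mul _).symm))

lemma sum_divisors_ramanujanSum {q : ℕ} (hq : q ≠ 0) (n : ℕ) :
    ∑ d ∈ q.divisors, ramanujanSum d n = if q ∣ n then (q : ℂ) else 0 := by
  rw [← sum_nthRootsFinset_pow hq, IsPrimitiveRoot.nthRoots_one_eq_biUnion_primitiveRoots,
    Finset.sum_biUnion]
  · exact Finset.sum_congr rfl fun d hd ↦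
      ramanujanSum_eq_sum_primitiveRoots (Nat.pos_of_mem_divisors hd).ne' n
  · intro d _ e _ hde
    exact IsPrimitiveRoot.disjoint hde

lemma LSeriesHasSum_ramanujanSum {n : ℕ} (hn : n ≠ 0) {s : ℂ} (hs : 1 < s.re) :
    LSeriesHasSum (fun q ↦ ramanujanSum q n) s (sigmaC (1 - s) n / riemannZeta s) := by
  set g : ℕ → ℂ := fun q ↦ if q ∣ n then (q : ℂ) else 0 with hg
  have hinv := ArithmeticFunction.sum_eq_iff_sum_mul_moebius_eq.mp
    fun q (hq : 0 < q) ↦ sum_divisors_ramanujanSum hq.ne' n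
  have hgsum : LSeriesHasSum g s (sigmaC (1 - s) n) := by
    have : sigmaC (1 - s) n = ∑ d ∈ n.divisors, LSeries.term g s d := by
      refine Finset.sum_congr rfl fun d hd ↦ ?_
      have hd0 := (Nat.pos_of_mem_divisors hd).ne'
      have hd0' : (d : ℂ) ≠ 0 := by exact_mod_cast hd0
      simp only [LSeries.term_of_ne_zero hd0, hg]
      rw [if_pos (Nat.dvd_of_mem_divisors hd),
        Complex.cpow_sub _ _ hd0', Complex.cpow_one]
    rw [LSeriesHasSum, this]
    refine hasSum_sum_of_ne_finset_zero fun d hd ↦ ?_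
    have : ¬ d ∣ n := by simpa [hn] using hd
    simp [LSeries.term, hg, this]
  have hμ := ArithmeticFunction.LSeriesSummable_moebius_iff.mpr hs
  have hμζ := ArithmeticFunction.LSeries_zeta_mul_Lseries_moebius hs
  rw [ArithmeticFunction.LSeries_zeta_eq_riemannZeta hs] at hμζ
  have h := hμ.LSeriesHasSum.convolution hgsum
  have hζ := riemannZeta_ne_zero_of_one_lt_re hs
  have hval : LSeries (fun n ↦ ((ArithmeticFunction.moebius n : ℤ) : ℂ)) s * sigmaC (1 - s) n =
      sigmaC (1 - s) n / riemannZeta s := by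
    rw [eq_div_iff hζ]
    linear_combination sigmaC (1 - s) n * hμζ
  rw [hval] at h
  refine (LSeriesHasSum_congr s _ fun {q} hq ↦ ?_).mp h
  rw [LSeries.convolution_def, ← hinv q (Nat.pos_of_ne_zero hq)]

end RamanujanSum

section RamanujanFormula

lemma hasSum_pnat_iff_of_map_zero {f : ℕ → ℂ} (hf : f 0 = 0) {a : ℂ} :
    HasSum (fun n : ℕ+ ↦ f n) a ↔ HasSum f a := by
  refine PNat.coe_injective.hasSum_iff fun n hn ↦ ?_
  have : n = 0 := by
    by_contra h
    exact hn ⟨⟨n, Nat.pos_of_ne_zero h⟩, rfl⟩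
  rw [this, hf]

lemma hasSum_pnat_cpow {z : ℂ} (hz : 1 < z.re) :
    HasSum (fun n : ℕ+ ↦ (n : ℂ) ^ (-z)) (riemannZeta z) := by
  have h := LSeriesHasSum_one hz
  rw [LSeriesHasSum, ← hasSum_pnat_iff_of_map_zero (LSeries.term_zero _ _)] at h
  convert h using 1
  ext n
  simp [Complex.cpow_neg]

lemma hasSum_prod_mul {ι κ : Type*} {f : ι → ℂ} {g : κ → ℂ} {a b : ℂ} (hf : HasSum f a)
    (hg : HasSum g b) : HasSum (fun p : ι × κ ↦ f p.1 * g p.2) (a * b) :=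
  hf.mul hg (summable_mul_of_summable_norm (f := f) (g := g) hf.summable.norm hg.summable.norm)

lemma hasSum_divisors_cpow (z : ℂ) (n : ℕ+) :
    HasSum (fun d : ℕ+ ↦ if (d : ℕ) ∣ n then (d : ℂ) ^ z else 0) (sigmaC z n) := by
  refine (hasSum_pnat_iff_of_map_zero (f := fun d ↦ if d ∣ (n : ℕ) then (d : ℂ) ^ z else 0) (by simp)).mpr ?_
  rw [sigmaC, Finset.sum_congr rfl (g := fun d : ℕ ↦ if d ∣ (n : ℕ) then (d : ℂ) ^ z else 0)
    fun d hd ↦ (if_pos (Nat.dvd_of_mem_divisors hd)).symm]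
  refine hasSum_sum_of_ne_finset_zero fun d hd ↦ if_neg ?_
  simpa using hd

/-- Pairs of coprime positive integers. -/
abbrev CoprimePairs : Type := {p : ℕ+ × ℕ+ // Nat.Coprime p.1 p.2}

lemma bijective_gcd_smul :
    Function.Bijective fun p : ℕ+ × CoprimePairs ↦ (p.1 * p.2.1.1, p.1 * p.2.1.2) := by
  constructor
  · rintro ⟨g, ⟨⟨e, f⟩, hc⟩⟩ ⟨g', ⟨⟨e', f'⟩, hc'⟩⟩ h
    simp only [Prod.mk.injEq] at h hc hc'
    have h1 := congrArg PNat.val h.1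
    have h2 := congrArg PNat.val h.2
    simp only [PNat.mul_coe] at h1 h2
    have hg : (g : ℕ) = g' := by
      have := congrArg₂ Nat.gcd h1 h2
      rwa [Nat.gcd_mul_left, Nat.gcd_mul_left, hc.gcd_eq_one, hc'.gcd_eq_one, mul_one,
        mul_one] at this
    obtain rfl := PNat.coe_injective hg
    obtain rfl := mul_left_cancel h.1
    obtain rfl := mul_left_cancel h.2
    rfl
  · rintro ⟨a, b⟩
    obtain ⟨e, he⟩ := PNat.gcd_dvd_left a b
    obtain ⟨f, hf⟩ := PNat.gcd_dvd_right a b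
    refine ⟨(PNat.gcd a b, ⟨(e, f), ?_⟩), Prod.ext he.symm hf.symm⟩
    have hg : 0 < Nat.gcd a b := (PNat.gcd a b).pos
    have h1 := congrArg PNat.val he
    have h2 := congrArg PNat.val hf
    simp only [PNat.mul_coe, PNat.gcd_coe] at h1 h2
    have := Nat.gcd_mul_left (Nat.gcd a b) e f
    rw [← h1, ← h2] at this
    exact Nat.eq_of_mul_eq_mul_left hg (by rw [← this, mul_one])

/-- Parametrization of the triples `(n, d₁, d₂)` with `d₁ ∣ n` and `d₂ ∣ n`. -/
def divisorTriple (p : ℕ+ × ℕ+ × CoprimePairs) : ℕ+ × ℕ+ × ℕ+ :=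
  (p.1 * (p.2.1 * (p.2.2.1.1 * p.2.2.1.2)), p.2.1 * p.2.2.1.1, p.2.1 * p.2.2.1.2)

lemma divisorTriple_injective : Function.Injective divisorTriple := by
  rintro ⟨m, p⟩ ⟨m', p'⟩ h
  simp only [divisorTriple, Prod.mk.injEq] at h
  obtain rfl : p = p' := bijective_gcd_smul.1 (Prod.ext h.2.1 h.2.2)
  rw [mul_right_cancel h.1]

lemma mem_range_divisorTriple {n a b : ℕ+} (ha : a ∣ n) (hb : b ∣ n) :
    (n, a, b) ∈ Set.range divisorTriple := by
  obtain ⟨⟨g, ⟨⟨e, f⟩, hc⟩⟩, h⟩ := bijective_gcd_smul.2 (a, b)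
  simp only [Prod.mk.injEq] at h
  obtain ⟨rfl, rfl⟩ := h
  have hdvd : g * (e * f) ∣ n := by
    obtain ⟨k, rfl⟩ := (dvd_mul_right g e).trans ha
    rw [PNat.dvd_iff] at ha hb ⊢
    simp only [PNat.mul_coe] at ha hb ⊢
    exact mul_dvd_mul_left _ (Nat.Coprime.mul_dvd_of_dvd_of_dvd hc
      (Nat.dvd_of_mul_dvd_mul_left g.pos ha) (Nat.dvd_of_mul_dvd_mul_left g.pos hb))
  obtain ⟨m, rfl⟩ := hdvd
  exact ⟨(m, g, ⟨(e, f), hc⟩), by simp [divisorTriple, mul_comm]⟩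

lemma pnat_mul_cpow (m n : ℕ+) (z : ℂ) : ((m * n : ℕ+) : ℂ) ^ z = (m : ℂ) ^ z * (n : ℂ) ^ z := by
  rw [PNat.mul_coe, Nat.cast_mul, Complex.natCast_mul_natCast_cpow]

lemma hasSum_coprimePairs {u v : ℂ} (hu : 1 < u.re) (hv : 1 < v.re) :
    HasSum (fun c : CoprimePairs ↦ (c.1.1 : ℂ) ^ (-u) * (c.1.2 : ℂ) ^ (-v))
      (riemannZeta u * riemannZeta v / riemannZeta (u + v)) := by
  have huv : 1 < (u + v).re := by
    rw [Complex.add_re]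
    linarith
  set k : CoprimePairs → ℂ := fun c ↦ (c.1.1 : ℂ) ^ (-u) * (c.1.2 : ℂ) ^ (-v) with hk
  have h1 := hasSum_prod_mul (hasSum_pnat_cpow hu) (hasSum_pnat_cpow hv)
  have hksum : Summable k := h1.summable.subtype {p | Nat.Coprime p.1 p.2}
  have h2 := hasSum_prod_mul (hasSum_pnat_cpow huv) hksum.hasSum
  rw [← (Equiv.ofBijective _ bijective_gcd_smul).hasSum_iff] at h1
  have hfun : ((fun p : ℕ+ × ℕ+ ↦ (p.1 : ℂ) ^ (-u) * (p.2 : ℂ) ^ (-v)) ∘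
      Equiv.ofBijective _ bijective_gcd_smul) =
      fun p : ℕ+ × CoprimePairs ↦ (p.1 : ℂ) ^ (-(u + v)) * k p.2 := by
    ext ⟨g, c⟩
    have hg : (g : ℂ) ≠ 0 := by exact_mod_cast g.ne_zero
    simp only [Function.comp_apply, Equiv.ofBijective_apply, hk, pnat_mul_cpow]
    rw [neg_add, Complex.cpow_add _ _ hg]
    ring
  rw [hfun] at h1
  rw [h1.unique h2, mul_div_cancel_left₀ _ (riemannZeta_ne_zero_of_one_lt_re huv)]
  exact hksum.hasSum

lemma hasSum_divisorTriple {a b s : ℂ} (hs : 1 < s.re) (hsa : 1 < (s - a).re)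
    (hsb : 1 < (s - b).re) (hsab : 1 < (s - a - b).re) :
    HasSum (fun p : ℕ+ × ℕ+ × ℕ+ ↦ (if (p.2.1 : ℕ) ∣ p.1 then (p.2.1 : ℂ) ^ a else 0) *
      (if (p.2.2 : ℕ) ∣ p.1 then (p.2.2 : ℂ) ^ b else 0) * (p.1 : ℂ) ^ (-s))
      (riemannZeta s * (riemannZeta (s - a - b) *
        (riemannZeta (s - a) * riemannZeta (s - b) / riemannZeta (s - a + (s - b))))) := by
  have htriple := hasSum_prod_mul (hasSum_pnat_cpow hs)
    (hasSum_prod_mul (hasSum_pnat_cpow hsab) (hasSum_coprimePairs hsa hsb))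
  refine (divisorTriple_injective.hasSum_iff ?_).mp ?_
  · rintro ⟨n, d, d'⟩ hn
    by_cases h1 : (d : ℕ) ∣ n
    · by_cases h2 : (d' : ℕ) ∣ n
      · exact absurd (mem_range_divisorTriple (PNat.dvd_iff.mpr h1) (PNat.dvd_iff.mpr h2)) hn
      · simp only [if_neg h2, mul_zero, zero_mul]
    · simp only [if_neg h1, zero_mul]
  · refine htriple.congr_fun fun p ↦ ?_
    obtain ⟨m, g, ⟨⟨e, f⟩, hc⟩⟩ := p
    have hg : (g : ℂ) ≠ 0 := by exact_mod_cast g.ne_zero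
    have he : (e : ℂ) ≠ 0 := by exact_mod_cast e.ne_zero
    have hf : (f : ℂ) ≠ 0 := by exact_mod_cast f.ne_zero
    have h1 : ((g * e : ℕ+) : ℕ) ∣ (m * (g * (e * f)) : ℕ+) :=
      PNat.dvd_iff.mp ⟨m * f, by ac_rfl⟩
    have h2 : ((g * f : ℕ+) : ℕ) ∣ (m * (g * (e * f)) : ℕ+) :=
      PNat.dvd_iff.mp ⟨m * e, by ac_rfl⟩
    simp only [Function.comp_apply, divisorTriple, if_pos h1, if_pos h2, pnat_mul_cpow]
    have e1 : -(s - a - b) = -s + a + b := by ring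
    have e2 : -(s - a) = -s + a := by ring
    have e3 : -(s - b) = -s + b := by ring
    rw [e1, e2, e3, Complex.cpow_add _ _ hg, Complex.cpow_add _ _ hg, Complex.cpow_add _ _ he,
      Complex.cpow_add _ _ hf]
    ring

/-- Ramanujan's formula for the Dirichlet series of a product of two divisor sums. -/
lemma LSeriesHasSum_sigmaC_mul_sigmaC {a b s : ℂ} (hs : 1 < s.re) (hsa : 1 < (s - a).re)
    (hsb : 1 < (s - b).re) (hsab : 1 < (s - a - b).re) :
    LSeriesHasSum (fun n ↦ sigmaC a n * sigmaC b n) s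
      (riemannZeta s * riemannZeta (s - a) * riemannZeta (s - b) * riemannZeta (s - a - b) /
        riemannZeta (2 * s - a - b)) := by
  have hn := (hasSum_divisorTriple hs hsa hsb hsab).prod_fiberwise
    (g := fun n : ℕ+ ↦ sigmaC a n * sigmaC b n * (n : ℂ) ^ (-s)) fun n ↦ by
      have h := (hasSum_prod_mul (hasSum_divisors_cpow a n) (hasSum_divisors_cpow b n)).mul_right
        ((n : ℂ) ^ (-s))
      simp only at h ⊢
      exact h
  have hval : riemannZeta s * (riemannZeta (s - a - b) *
      (riemannZeta (s - a) * riemannZeta (s - b) / riemannZeta (s - a + (s - b)))) =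
      riemannZeta s * riemannZeta (s - a) * riemannZeta (s - b) * riemannZeta (s - a - b) /
        riemannZeta (2 * s - a - b) := by
    rw [show 2 * s - a - b = s - a + (s - b) by ring]
    ring
  rw [LSeriesHasSum, ← hval, ← hasSum_pnat_iff_of_map_zero (LSeries.term_zero _ _)]
  convert hn using 1
  ext n
  rw [LSeries.term_of_ne_zero n.ne_zero, Complex.cpow_neg, div_eq_mul_inv]

end RamanujanFormula

section SecondMoment

variable {U : ℝ}

lemma Weight.exists_finset_support (hU : 2 ≤ U) (W : Weight U) {y : ℝ} (hy : 0 < y) :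
    ∃ S : Finset ℕ+, ∀ n ∉ S, W.toFun ((n : ℕ) / y) = 0 := by
  obtain ⟨N, hN⟩ := exists_nat_gt (2 * y)
  refine ⟨Finset.Icc 1 N.succPNat, fun n hn ↦ W.eq_zero_of_large hU ?_⟩
  have hn' : N.succPNat < n := by simpa using hn
  have hlt : N + 1 < (n : ℕ) := by simpa [← PNat.coe_lt_coe] using hn'
  have : (N : ℝ) < (n : ℕ) := by exact_mod_cast (Nat.lt_succ_self N).trans hlt
  rw [lt_div_iff₀ hy]
  linarith

lemma Weight.tsum_ramanujanSum_eq_VI (hU : 2 ≤ U) (W : Weight U) {x : ℝ} (hx : 0 < x) {c : ℝ}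
    (hc : 1 < c) (n : ℕ+) :
    ∑' q : ℕ+, ramanujanSum q n * (W.toFun ((q : ℕ) / x) : ℂ) =
      VI c fun s ↦ sigmaC (1 - s) n / riemannZeta s * (mellinW W.toFun s * (x : ℂ) ^ s) := by
  have hsum : LSeriesSummable (fun q ↦ ramanujanSum q n) c :=
    (LSeriesHasSum_ramanujanSum n.ne_zero (by simpa using hc)).LSeriesSummable
  rw [W.tsum_eq_VI hU hx hsum]
  refine VI_congr fun s hs ↦ ?_
  rw [(LSeriesHasSum_ramanujanSum n.ne_zero (by rwa [hs])).LSeries_eq]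

lemma Weight.integrable_sigmaC_div_riemannZeta_mul (hU : 2 ≤ U) (W : Weight U) {x : ℝ}
    (hx : 0 < x) {c : ℝ} (hc : 1 < c) (n : ℕ+) :
    Integrable fun t : ℝ ↦ sigmaC (1 - (c + t * Complex.I)) n / riemannZeta (c + t * Complex.I) *
      (mellinW W.toFun (c + t * Complex.I) * (x : ℂ) ^ ((c : ℂ) + t * Complex.I)) := by
  have hsum : LSeriesSummable (fun q ↦ ramanujanSum q n) c :=
    (LSeriesHasSum_ramanujanSum n.ne_zero (by simpa using hc)).LSeriesSummable
  refine (W.integrable_LSeries_mul hU hx hsum).congr (Eventually.of_forall fun t ↦ ?_)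
  have hre : 1 < ((c : ℂ) + t * Complex.I).re := by simpa using hc
  simp only [(LSeriesHasSum_ramanujanSum n.ne_zero hre).LSeries_eq]

lemma Weight.tsum_sigmaC_mul_sigmaC_eq_VI (hU : 2 ≤ U) (W : Weight U) {y : ℝ} (hy : 0 < y)
    {s₁ s₂ : ℂ} (h₁ : 1 < s₁.re) (h₂ : 1 < s₂.re) :
    ∑' n : ℕ+, sigmaC (1 - s₁) n * sigmaC (1 - s₂) n * (W.toFun ((n : ℕ) / y) : ℂ) =
      VI (3 / 2) fun s₃ ↦
        riemannZeta s₃ * riemannZeta (s₃ + s₁ - 1) * riemannZeta (s₃ + s₂ - 1) *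
            riemannZeta (s₃ + s₁ + s₂ - 2) / riemannZeta (2 * s₃ + s₁ + s₂ - 2) *
          mellinW W.toFun s₃ * (y : ℂ) ^ s₃ := by
  have key : ∀ s₃ : ℂ, s₃.re = 3 / 2 →
      LSeriesHasSum (fun n ↦ sigmaC (1 - s₁) n * sigmaC (1 - s₂) n) s₃
        (riemannZeta s₃ * riemannZeta (s₃ + s₁ - 1) * riemannZeta (s₃ + s₂ - 1) *
            riemannZeta (s₃ + s₁ + s₂ - 2) / riemannZeta (2 * s₃ + s₁ + s₂ - 2)) := by
    intro s₃ h₃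
    have h := LSeriesHasSum_sigmaC_mul_sigmaC (a := 1 - s₁) (b := 1 - s₂) (s := s₃)
      (by linarith) (by simp only [Complex.sub_re, Complex.one_re]; linarith)
      (by simp only [Complex.sub_re, Complex.one_re]; linarith)
      (by simp only [Complex.sub_re, Complex.one_re]; linarith)
    rwa [show s₃ - (1 - s₁) - (1 - s₂) = s₃ + s₁ + s₂ - 2 by ring,
      show 2 * s₃ - (1 - s₁) - (1 - s₂) = 2 * s₃ + s₁ + s₂ - 2 by ring,
      ← sub_add, ← sub_add, sub_add_eq_add_sub, sub_add_eq_add_sub] at h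
  rw [W.tsum_eq_VI hU hy (a := fun n ↦ sigmaC (1 - s₁) n * sigmaC (1 - s₂) n) (c := 3 / 2)
    (key _ (by norm_num)).LSeriesSummable]
  refine VI_congr fun s₃ h₃ ↦ ?_
  rw [(key s₃ h₃).LSeries_eq, mul_assoc _ (mellinW _ _)]

end SecondMoment

/-- Expression of `C(x,y)` as a double contour integral of `H(s₁,s₂;y)`. -/
theorem second_moment_as_double_integral (U : ℝ) (hU : 2 ≤ U) (W : Weight U)
    (x y : ℝ) (hx : 0 < x) (hy : 0 < y)
    (c₁ c₂ : ℝ) (h1 : 1 < c₁) (h12 : c₁ < c₂) (h2 : c₂ < 2) :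
    Cxy W x y =
      VI c₁ (fun s₁ => VI c₂ (fun s₂ =>
        VI (3 / 2) (fun s₃ =>
            riemannZeta s₃ * riemannZeta (s₃ + s₁ - 1) * riemannZeta (s₃ + s₂ - 1) *
                riemannZeta (s₃ + s₁ + s₂ - 2) / riemannZeta (2 * s₃ + s₁ + s₂ - 2) *
              mellinW W.toFun s₃ * (y : ℂ) ^ s₃) *
          ((x : ℂ) ^ (s₁ + s₂) / (riemannZeta s₁ * riemannZeta s₂)) *
          mellinW W.toFun s₁ * mellinW W.toFun s₂)) := by
  have hc₂ : 1 < c₂ := h1.trans h12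
  obtain ⟨S, hS⟩ := W.exists_finset_support hU hy
  set G : ℕ+ → ℂ → ℂ := fun n s ↦
    sigmaC (1 - s) n / riemannZeta s * (mellinW W.toFun s * (x : ℂ) ^ s) with hG
  have hint : ∀ {c : ℝ}, 1 < c → ∀ n, Integrable fun t : ℝ ↦ G n (c + t * Complex.I) :=
    fun hc n ↦ W.integrable_sigmaC_div_riemannZeta_mul hU hx hc n
  have hsq : ∀ n : ℕ+, (∑' q : ℕ+, ramanujanSum q n * (W.toFun ((q : ℕ) / x) : ℂ)) ^ 2 =
      VI c₁ (G n) * VI c₂ (G n) := by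
    intro n
    rw [sq]
    nth_rw 1 [W.tsum_ramanujanSum_eq_VI hU hx h1 n]
    rw [W.tsum_ramanujanSum_eq_VI hU hx hc₂ n]
  have hC : Cxy W x y = VI c₁ fun s₁ ↦ VI c₂ fun s₂ ↦
      ∑ n ∈ S, G n s₁ * (G n s₂ * (W.toFun ((n : ℕ) / y) : ℂ)) := by
    rw [Cxy, tsum_eq_sum fun n hn ↦ by rw [hS n hn, Complex.ofReal_zero, mul_zero]]
    have hinner : ∀ s₁ : ℂ, VI c₂ (fun s₂ ↦
        ∑ n ∈ S, G n s₁ * (G n s₂ * (W.toFun ((n : ℕ) / y) : ℂ))) =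
        ∑ n ∈ S, G n s₁ * (VI c₂ (G n) * (W.toFun ((n : ℕ) / y) : ℂ)) := by
      intro s₁
      rw [VI_finset_sum _ _ _ fun n _ ↦ ((hint hc₂ n).mul_const _).const_mul _]
      simp only [VI_const_mul, VI_mul_const]
    simp only [hinner]
    rw [VI_finset_sum _ _ _ fun n _ ↦ (hint h1 n).mul_const _]
    simp only [VI_mul_const, hsq, mul_assoc]
  rw [hC]
  refine VI_congr fun s₁ hs₁ ↦ VI_congr fun s₂ hs₂ ↦ ?_
  rw [← W.tsum_sigmaC_mul_sigmaC_eq_VI hU hy (hs₁ ▸ h1) (hs₂ ▸ hc₂),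
    tsum_eq_sum (s := S) fun n hn ↦ by rw [hS n hn, Complex.ofReal_zero, mul_zero],
    Finset.sum_mul, Finset.sum_mul, Finset.sum_mul]
  refine Finset.sum_congr rfl fun n _ ↦ ?_
  rw [Complex.cpow_add _ _ (by exact_mod_cast hx.ne')]
  simp only [hG]
  ring
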